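/- arXiv:2512.14954 — 3 statements merged into one kernel-verified Lean document; each statement's English description precedes it below -/
import Mathlib

section
/- Lemma 2 (adjacent vocabulary transition). Let V_{M'} ⪯ V_{M'+1} be adjacent BPE vocabularies with newly added token t_{M'+1} = t_{M'+1}^left · t_{M'+1}^right, and let μ be a language model over byte sequences. Let e be a valid encoding over V_{M'+1} and set e' = decode_{M'+1→M'}(e) = demerge_{M'+1}(e). If the last token of e is not t_{M'+1}^left, then P_μ(e; M'+1) = P_μ(e'; M'). If the last token of e equals t_{M'+1}^left, then P_μ(e; M'+1) = P_μ(e'; M') − P_μ(e' · t_{M'+1}^right; M'), where e' · t_{M'+1}^right denotes e' with the token t_{M'+1}^right appended. -/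
open scoped ENNReal

/-- A BPE vocabulary with `M` merge rules over alphabet `α` with end-of-string
symbol `eos`.  The `i`-th merged token (0-based) is `left i ++ right i`, where each
of `left i`, `right i` is either a single non-`eos` alphabet symbol or an earlier
merged token.  Tokens of the vocabulary are pairwise distinct. -/
structure BPE (α : Type*) (eos : α) (M : ℕ) where
  left : ℕ → List α
  right : ℕ → List α
  left_ok : ∀ i < M, (∃ a : α, a ≠ eos ∧ left i = [a]) ∨ ∃ j < i, left i = left j ++ right j
  right_ok : ∀ i < M, (∃ a : α, a ≠ eos ∧ right i = [a]) ∨ ∃ j < i, right i = left j ++ right j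
  distinct : ∀ i < M, ∀ j < M, left i ++ right i = left j ++ right j → i = j

variable {α : Type*} [DecidableEq α] {eos : α} {M : ℕ}

/-- One merge pass: scan left to right, replacing each leftmost non-overlapping
adjacent pair `(l, r)` by the merged token `l ++ r`. -/
def mergeStep (l r : List α) : List (List α) → List (List α)
  | [] => []
  | [x] => [x]
  | x :: y :: rest =>
      if x = l ∧ y = r then (l ++ r) :: mergeStep l r rest
      else x :: mergeStep l r (y :: rest)

/-- One demerge pass: replace every occurrence of the token `l ++ r` by the pair `(l, r)`. -/
def demergeStep (l r : List α) (e : List (List α)) : List (List α) :=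
  (e.map fun t => if t = l ++ r then [l, r] else [t]).flatten

/-- `merge_{i+1}` (0-based index `i`). -/
def BPE.mergeAt (B : BPE α eos M) (i : ℕ) (e : List (List α)) : List (List α) :=
  mergeStep (B.left i) (B.right i) e

/-- `demerge_{i+1}` (0-based index `i`). -/
def BPE.demergeAt (B : BPE α eos M) (i : ℕ) (e : List (List α)) : List (List α) :=
  demergeStep (B.left i) (B.right i) e

/-- `B.encodeRel K n e` applies the merges with 0-based indices `K, K+1, …, K+n-1`
in order; this is the relative encoding `encode_{K → K+n}`. -/
def BPE.encodeRel (B : BPE α eos M) (K : ℕ) : ℕ → List (List α) → List (List α)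
  | 0, e => e
  | n + 1, e => B.mergeAt (K + n) (B.encodeRel K n e)

/-- `B.decodeRel K n e` applies the demerges with 0-based indices `K+n-1, …, K+1, K`
in order; this is the relative decoding `decode_{K+n → K}`. -/
def BPE.decodeRel (B : BPE α eos M) (K : ℕ) : ℕ → List (List α) → List (List α)
  | 0, e => e
  | n + 1, e => B.decodeRel K n (B.demergeAt (K + n) e)

/-- The canonical encoding `encode(s; N)` of a byte string `s` with the first `N` merges. -/
def BPE.encode (B : BPE α eos M) (N : ℕ) (s : List α) : List (List α) :=
  B.encodeRel 0 N (s.map fun a => [a])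

/-- `decode`: concatenate the byte strings of the tokens. -/
def decodeBytes (e : List (List α)) : List α := e.flatten

/-- An encoding over `V_N` is valid (canonical) if re-encoding its decoded string gives it back. -/
def BPE.Valid (B : BPE α eos M) (N : ℕ) (e : List (List α)) : Prop :=
  B.encode N (decodeBytes e) = e

/-- `t` is a token of the truncated vocabulary `V_N` (alphabet symbols and the first `N` merges). -/
def BPE.IsTok (B : BPE α eos M) (N : ℕ) (t : List α) : Prop :=
  (∃ a : α, t = [a]) ∨ ∃ i < N, t = B.left i ++ B.right i

/-- `e` is a token sequence over the truncated vocabulary `V_N`. -/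
def BPE.IsEnc (B : BPE α eos M) (N : ℕ) (e : List (List α)) : Prop :=
  ∀ t ∈ e, B.IsTok N t

/-- `e` (over `V_M`) is a relative cover encoding of `e'` (over `V_{M'}`):
(1) `e` is a prefix of the canonical `V_M`-encoding of some byte sequence terminating
with `eos`, and (2) writing `e = e₀ ++ [t]`, for some index `k < |e'|` the relative
decoding of `e₀` equals the first `k` tokens of `e'` and the remaining tokens
`e'.drop k` form a prefix of the relative decoding of the last token `t`. -/
def BPE.IsCover (B : BPE α eos M) (M' : ℕ) (e' e : List (List α)) : Prop :=
  (∃ x : List α, x.getLast? = some eos ∧ e <+: B.encode M x) ∧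
  ∃ (e₀ : List (List α)) (t : List α), e = e₀ ++ [t] ∧
    ∃ k < e'.length,
      B.decodeRel M' (M - M') e₀ = e'.take k ∧
      e'.drop k <+: B.decodeRel M' (M - M') [t]

/-- The set `cover_{M'→M}(e')` of all relative cover encodings of `e'`. -/
def BPE.cover (B : BPE α eos M) (M' : ℕ) (e' : List (List α)) : Set (List (List α)) :=
  {e | B.IsCover M' e' e}

/-- `P_μ(e; N)`: the probability, under the language model `μ` on byte sequences
terminating with `eos`, that the canonical `V_N`-encoding begins with `e`. -/
noncomputable def BPE.Pr (B : BPE α eos M) (N : ℕ)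
    (μ : PMF {x : List α // x.getLast? = some eos}) (e : List (List α)) : ℝ≥0∞ :=
  μ.toOuterMeasure {x | e <+: B.encode N x.val}


theorem mem_mergeStep {l r t : List α} {y : List (List α)} (h : t ∈ mergeStep l r y) :
    t = l ++ r ∨ t ∈ y := by
  induction y using mergeStep.induct l r with
  | case1 => simp [mergeStep] at h
  | case2 x => simpa [mergeStep] using Or.inr h
  | case3 x y rest hxy ih =>
    rw [mergeStep, if_pos hxy, List.mem_cons] at h
    rcases h with h | h
    · exact Or.inl h
    · have := ih h
      grind
  | case4 x y rest hxy ih =>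
    rw [mergeStep, if_neg hxy, List.mem_cons] at h
    rcases h with h | h
    · simp [h]
    · have := ih h
      grind

theorem demergeStep_cons (l r t : List α) (e : List (List α)) :
    demergeStep l r (t :: e) = (if t = l ++ r then [l, r] else [t]) ++ demergeStep l r e := by
  simp [demergeStep]

theorem demergeStep_isPrefix {l r : List α} {e c : List (List α)} (h : e <+: c) :
    demergeStep l r e <+: demergeStep l r c := by
  obtain ⟨z, rfl⟩ := h
  simp [demergeStep]

theorem demergeStep_mergeStep {l r : List α} {y : List (List α)} (h : l ++ r ∉ y) :
    demergeStep l r (mergeStep l r y) = y := by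
  induction y using mergeStep.induct l r with
  | case1 => simp [mergeStep, demergeStep]
  | case2 x =>
    have hx : x ≠ l ++ r := by grind
    simp [mergeStep, demergeStep, hx]
  | case3 x y rest hxy ih =>
    rw [mergeStep, if_pos hxy, demergeStep_cons, if_pos rfl, ih (by grind), hxy.1, hxy.2]
    rfl
  | case4 x y rest hxy ih =>
    rw [mergeStep, if_neg hxy, demergeStep_cons, if_neg (by grind), ih (by grind)]
    rfl

/-- A merge pass splits at any cut that does not separate a pair about to be merged. -/
theorem mergeStep_append {l r : List α} {a z : List (List α)}
    (h : ¬((mergeStep l r a).getLast? = some l ∧ z.head? = some r)) :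
    mergeStep l r (a ++ z) = mergeStep l r a ++ mergeStep l r z := by
  induction a using mergeStep.induct l r with
  | case1 => simp [mergeStep]
  | case2 x =>
    cases z with
    | nil => simp [mergeStep]
    | cons y z =>
      have hxy : ¬(x = l ∧ y = r) := by simpa [mergeStep] using h
      simp [mergeStep, hxy]
  | case3 x y rest hxy ih =>
    rw [mergeStep, if_pos hxy] at h ⊢
    rw [List.cons_append, List.cons_append, mergeStep, if_pos hxy, List.cons_append, ih]
    rintro ⟨hl, hz⟩
    exact h ⟨by simp [List.getLast?_cons, hl], hz⟩
  | case4 x y rest hxy ih =>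
    rw [mergeStep, if_neg hxy] at h ⊢
    rw [List.cons_append, List.cons_append, mergeStep, if_neg hxy, List.cons_append,
      ← List.cons_append, ih]
    rintro ⟨hl, hz⟩
    exact h ⟨by simp [List.getLast?_cons, hl], hz⟩

theorem not_mergeStep_isPrefix {l r : List α} (hr : r ≠ []) {a z : List (List α)}
    (hl : (mergeStep l r a).getLast? = some l) :
    ¬ mergeStep l r a <+: mergeStep l r (a ++ r :: z) := by
  induction a using mergeStep.induct l r with
  | case1 => simp [mergeStep] at hl
  | case2 x =>
    have hx : x = l := by simpa [mergeStep] using hl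
    subst hx
    simp [mergeStep, hr]
  | case3 x y rest hxy ih =>
    rw [mergeStep, if_pos hxy] at hl ⊢
    rw [List.cons_append, List.cons_append, mergeStep, if_pos hxy, List.prefix_cons_inj]
    apply ih
    cases hm : mergeStep l r rest with
    | nil => simp [hm, hr] at hl
    | cons b m => simpa [hm] using hl
  | case4 x y rest hxy ih =>
    rw [mergeStep, if_neg hxy] at hl ⊢
    rw [List.cons_append, List.cons_append, mergeStep, if_neg hxy, List.prefix_cons_inj,
      ← List.cons_append]
    apply ih
    cases hm : mergeStep l r (y :: rest) with
    | nil =>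
      exfalso
      revert hm
      cases rest with
      | nil => simp [mergeStep]
      | cons b m => rw [mergeStep]; split <;> simp
    | cons b m => simpa [hm] using hl

/-- If `a` and `y` do not contain the merged token, then the merge of `a` is a prefix of the merge
of `y` exactly when `a` is a prefix of `y` whose end is not merged with the next token of `y`. -/
theorem mergeStep_isPrefix_iff {l r : List α} (hr : r ≠ []) {a y : List (List α)}
    (ha : l ++ r ∉ a) (hy : l ++ r ∉ y) :
    mergeStep l r a <+: mergeStep l r y ↔
      a <+: y ∧ ¬((mergeStep l r a).getLast? = some l ∧ a ++ [r] <+: y) := by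
  constructor
  · intro h
    refine ⟨?_, ?_⟩
    · simpa [demergeStep_mergeStep ha, demergeStep_mergeStep hy] using
        demergeStep_isPrefix (l := l) (r := r) h
    · rintro ⟨hl, z, rfl⟩
      rw [List.append_assoc] at h
      exact not_mergeStep_isPrefix hr hl h
  · rintro ⟨⟨z, rfl⟩, h⟩
    rw [mergeStep_append]
    · exact List.prefix_append _ _
    · rintro ⟨hl, hz⟩
      refine h ⟨hl, ?_⟩
      cases z with
      | nil => simp at hz
      | cons b z => simp_all

theorem BPE.left_ne_nil {β : Type*} {b : β} (B : BPE β b M) {i : ℕ} (hi : i < M) :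
    B.left i ≠ [] := by
  induction i using Nat.strong_induction_on with
  | _ i ih =>
    rcases B.left_ok i hi with ⟨a, -, h⟩ | ⟨j, hj, h⟩
    · simp [h]
    · simp [h, ih j hj (hj.trans hi)]

theorem BPE.right_ne_nil {β : Type*} {b : β} (B : BPE β b M) {i : ℕ} (hi : i < M) :
    B.right i ≠ [] := by
  rcases B.right_ok i hi with ⟨a, -, h⟩ | ⟨j, hj, h⟩
  · simp [h]
  · simp [h, B.left_ne_nil (hj.trans hi)]

theorem BPE.encode_succ (B : BPE α eos M) (N : ℕ) (s : List α) :
    B.encode (N + 1) s = mergeStep (B.left N) (B.right N) (B.encode N s) := by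
  simp [encode, encodeRel, mergeAt]

theorem BPE.isEnc_encode (B : BPE α eos M) (N : ℕ) (s : List α) : B.IsEnc N (B.encode N s) := by
  induction N with
  | zero =>
    intro t ht
    obtain ⟨a, -, rfl⟩ := List.mem_map.1 ht
    exact Or.inl ⟨a, rfl⟩
  | succ N ih =>
    intro t ht
    rw [encode_succ] at ht
    rcases mem_mergeStep ht with rfl | h
    · exact Or.inr ⟨N, N.lt_succ_self, rfl⟩
    · exact (ih t h).imp_right fun ⟨i, hi, hti⟩ => ⟨i, hi.trans N.lt_succ_self, hti⟩

theorem BPE.not_isTok {β : Type*} {b : β} (B : BPE β b M) {N : ℕ} (hN : N < M) :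
    ¬ B.IsTok N (B.left N ++ B.right N) := by
  rintro (⟨a, h⟩ | ⟨i, hi, h⟩)
  · have hlen := congrArg List.length h
    have hl := List.length_pos_iff.2 (B.left_ne_nil hN)
    have hr := List.length_pos_iff.2 (B.right_ne_nil hN)
    simp at hlen
    omega
  · exact hi.ne' (B.distinct N hN i (hi.trans hN) h)

theorem BPE.notMem_encode (B : BPE α eos M) {N : ℕ} (hN : N < M) (s : List α) :
    B.left N ++ B.right N ∉ B.encode N s :=
  fun h => B.not_isTok hN (B.isEnc_encode N s _ h)

theorem BPE.Valid.isPrefix_encode_succ_iff {B : BPE α eos M} {N : ℕ} (hN : N < M)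
    {e : List (List α)} (he : B.Valid (N + 1) e) (s : List α) :
    e <+: B.encode (N + 1) s ↔ B.demergeAt N e <+: B.encode N s ∧
      ¬(e.getLast? = some (B.left N) ∧ B.demergeAt N e ++ [B.right N] <+: B.encode N s) := by
  have hm : mergeStep (B.left N) (B.right N) (B.encode N (decodeBytes e)) = e := by
    rw [← B.encode_succ]
    exact he
  have hd : B.demergeAt N e = B.encode N (decodeBytes e) := by
    rw [← demergeStep_mergeStep (B.notMem_encode hN (decodeBytes e)), hm]
    rfl
  have key := mergeStep_isPrefix_iff (B.right_ne_nil hN) (B.notMem_encode hN (decodeBytes e))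
    (B.notMem_encode hN s)
  rwa [hm, ← hd, ← B.encode_succ] at key

theorem PMF.toReal_toOuterMeasure_diff {β : Type*} (p : PMF β) {s t : Set β} (h : t ⊆ s) :
    (p.toOuterMeasure (s \ t)).toReal
      = (p.toOuterMeasure s).toReal - (p.toOuterMeasure t).toReal := by
  let _ : MeasurableSpace β := ⊤
  have hm (u : Set β) : p.toOuterMeasure u = p.toMeasure u :=
    (p.toMeasure_apply_eq_toOuterMeasure_apply (MeasurableSpace.measurableSet_top)).symm
  simp only [hm]
  exact MeasureTheory.measureReal_sdiff h MeasurableSpace.measurableSet_top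

/-- **Lemma 2 (adjacent vocabulary transition).** For adjacent vocabularies
`V_{M'} ⪯ V_{M'+1}` with newly added token `t_{M'+1} = left · right`, a valid encoding
`e` over `V_{M'+1}` and `e' = demerge_{M'+1}(e)`:  if the last token of `e` is not
`t_{M'+1}^left` then `P_μ(e; M'+1) = P_μ(e'; M')`; otherwise
`P_μ(e; M'+1) = P_μ(e'; M') − P_μ(e' · t_{M'+1}^right; M')`. -/
theorem adjacent_vocabulary_transition {α : Type*} [DecidableEq α] [Fintype α] {eos : α}
    {M' : ℕ} (B : BPE α eos (M' + 1))
    (μ : PMF {x : List α // x.getLast? = some eos})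
    (e : List (List α)) (he : B.Valid (M' + 1) e) :
    (e.getLast? ≠ some (B.left M') →
      (B.Pr (M' + 1) μ e).toReal = (B.Pr M' μ (B.demergeAt M' e)).toReal) ∧
    (e.getLast? = some (B.left M') →
      (B.Pr (M' + 1) μ e).toReal =
        (B.Pr M' μ (B.demergeAt M' e)).toReal
          - (B.Pr M' μ (B.demergeAt M' e ++ [B.right M'])).toReal) := by
  have key := fun s => he.isPrefix_encode_succ_iff M'.lt_succ_self s
  constructor
  · intro hl
    simp only [BPE.Pr, key, hl, false_and, not_false_eq_true, and_true]
  · intro hl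
    simp only [BPE.Pr, key, hl, true_and]
    exact μ.toReal_toOuterMeasure_diff fun x hx => (List.prefix_append _ _).trans hx
end

section
/- Prefix-freeness of the relative cover set. Let V_{M'} ⪯ V_M be BPE vocabularies and let e' be a valid encoding over V_{M'}. Then no element of cover_{M'→M}(e') is a proper prefix of another element of cover_{M'→M}(e'). Consequently, for any two distinct e_1, e_2 ∈ cover_{M'→M}(e'), no byte sequence x terminating with EOS has encode(x; M) beginning with both e_1 and e_2. -/
open scoped ENNReal

variable {α : Type*} [DecidableEq α] {eos : α} {M : ℕ}

theorem BPE.decodeRel_append (B : BPE α eos M) (K n : ℕ) (e f : List (List α)) :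
    B.decodeRel K n (e ++ f) = B.decodeRel K n e ++ B.decodeRel K n f := by
  induction n generalizing e f with
  | zero => rfl
  | succ n ih => simp [BPE.decodeRel, BPE.demergeAt, demergeStep, ← ih]

theorem BPE.IsCover.length_le_decodeRel {B : BPE α eos M} {M' : ℕ} {e' e : List (List α)}
    (h : B.IsCover M' e' e) : e'.length ≤ (B.decodeRel M' (M - M') e).length := by
  obtain ⟨_, e₀, t, rfl, k, hk, h₀, ht⟩ := h
  have := ht.length_le
  rw [B.decodeRel_append, h₀]
  simp only [List.length_append, List.length_take, List.length_drop] at *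
  omega

/-- Two relative cover encodings of the same encoding, one a prefix of the other, coincide. -/
theorem BPE.IsCover.eq_of_prefix {B : BPE α eos M} {M' : ℕ} {e' e₁ e₂ : List (List α)}
    (h₁ : B.IsCover M' e' e₁) (h₂ : B.IsCover M' e' e₂) (h : e₁ <+: e₂) : e₁ = e₂ := by
  have hlen := h₁.length_le_decodeRel
  obtain ⟨_, e₀, t, rfl, k, hk, h₀, _⟩ := h₂
  rcases List.prefix_concat_iff.1 h with rfl | ⟨s, rfl⟩
  · rfl
  · have := congrArg List.length h₀
    rw [B.decodeRel_append] at this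
    simp only [List.length_append, List.length_take] at this
    omega

/-- **Prefix-freeness of the relative cover set.** For a valid encoding `e'` over
`V_{M'}`, no element of `cover_{M'→M}(e')` is a proper prefix of another; consequently,
for distinct `e₁, e₂` in the cover set, no byte sequence terminating with `EOS` has its
canonical `V_M`-encoding beginning with both. -/
theorem cover_prefix_free {α : Type*} [DecidableEq α] [Fintype α] {eos : α} {M : ℕ}
    (B : BPE α eos M) (M' : ℕ) (hM : M' ≤ M)
    (e' : List (List α)) (he' : B.Valid M' e') :
    (∀ e₁ ∈ B.cover M' e', ∀ e₂ ∈ B.cover M' e', e₁ ≠ e₂ → ¬ e₁ <+: e₂) ∧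
    (∀ e₁ ∈ B.cover M' e', ∀ e₂ ∈ B.cover M' e', e₁ ≠ e₂ →
      ∀ x : List α, x.getLast? = some eos →
        ¬ (e₁ <+: B.encode M x ∧ e₂ <+: B.encode M x)) := by
  have key : ∀ e₁ ∈ B.cover M' e', ∀ e₂ ∈ B.cover M' e', e₁ ≠ e₂ → ¬ e₁ <+: e₂ :=
    fun _ h₁ _ h₂ hne h => hne (BPE.IsCover.eq_of_prefix h₁ h₂ h)
  refine ⟨key, fun e₁ h₁ e₂ h₂ hne x _ hx => ?_⟩
  rcases List.prefix_or_prefix_of_prefix hx.1 hx.2 with h | h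
  · exact key e₁ h₁ e₂ h₂ hne h
  · exact key e₂ h₂ e₁ h₁ hne.symm h
end

section
/- Canonical BPE encodings contain no mergeable adjacent pair (tokenization bias). Let V_M be a BPE vocabulary. For every byte string s, the canonical encoding encode(s; M) contains no adjacent pair of tokens equal to (t_i^left, t_i^right) for any merge rule i ≤ M; that is, there is no position j and no index i ≤ M with encode(s; M)[j] = t_i^left and encode(s; M)[j+1] = t_i^right. Consequently, any token sequence containing such an adjacent pair is not a prefix of the canonical encoding of any byte string. -/
open scoped ENNReal

variable {α : Type*} [DecidableEq α] {eos : α} {M : ℕ}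

theorem head_mergeStep (l r y : List α) (e : List (List α)) :
    ∃ t e', mergeStep l r (y :: e) = t :: e' ∧ (t = y ∨ t = l ++ r) := by
  cases e with
  | nil => exact ⟨y, [], by simp [mergeStep]⟩
  | cons z e =>
    rw [mergeStep]
    split
    · exact ⟨_, _, rfl, Or.inr rfl⟩
    · exact ⟨_, _, rfl, Or.inl rfl⟩

/-- An adjacent pair in the output of a merge pass that does not involve the merged token was
already adjacent in the input, and is not the pair being merged. -/
theorem pair_infix_of_infix_mergeStep {l r p q : List α} (hp : p ≠ l ++ r) (hq : q ≠ l ++ r)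
    (e : List (List α)) (h : [p, q] <:+: mergeStep l r e) :
    [p, q] <:+: e ∧ ¬ (p = l ∧ q = r) := by
  fun_induction mergeStep l r e with
  | case1 => simp at h
  | case2 x => simpa using h.length_le
  | case3 x y rest hxy ih =>
    rcases List.infix_cons_iff.1 h with h | h
    · exact absurd (List.cons_prefix_cons.1 h).1 hp
    · exact ⟨List.infix_cons (List.infix_cons (ih h).1), (ih h).2⟩
  | case4 x y rest hxy ih =>
    rcases List.infix_cons_iff.1 h with h | h
    · obtain ⟨t, e', he, ht⟩ := head_mergeStep l r y rest
      rw [he, List.cons_prefix_cons, List.cons_prefix_cons] at h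
      obtain ⟨rfl, rfl, -⟩ := h
      obtain rfl := ht.resolve_right hq
      exact ⟨⟨[], rest, rfl⟩, hxy⟩
    · exact ⟨List.infix_cons (ih h).1, (ih h).2⟩

namespace BPE

theorem token_ne_nil_of_lt {β : Type*} {eos : β} {M : ℕ} (B : BPE β eos M) {i : ℕ} (hi : i < M) :
    B.left i ≠ [] ∧ B.right i ≠ [] := by
  induction i using Nat.strong_induction_on with
  | _ i ih =>
    constructor
    · rcases B.left_ok i hi with ⟨a, -, h⟩ | ⟨j, hj, h⟩
      · simp [h]
      · simp [h, (ih j hj (hj.trans hi)).1]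
    · rcases B.right_ok i hi with ⟨a, -, h⟩ | ⟨j, hj, h⟩
      · simp [h]
      · simp [h, (ih j hj (hj.trans hi)).1]

/-- A symbol or a token merged before step `i` differs from every token merged at step `i` or
later. -/
theorem ne_merged_of_le {β : Type*} {eos : β} {M : ℕ} (B : BPE β eos M) {i j : ℕ} (hij : i ≤ j)
    (hj : j < M) {t : List β} (ht : (∃ a : β, a ≠ eos ∧ t = [a]) ∨ ∃ k < i, t = B.left k ++ B.right k) :
    t ≠ B.left j ++ B.right j := by
  rintro rfl
  rcases ht with ⟨a, -, h⟩ | ⟨k, hk, h⟩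
  · obtain ⟨hl, hr⟩ := B.token_ne_nil_of_lt hj
    rcases List.append_eq_singleton_iff.1 h with h | h
    · exact hl h.1
    · exact hr h.2
  · have := B.distinct j hj k (by omega) h
    omega

theorem not_pair_infix_encodeRel (B : BPE α eos M) (e : List (List α)) {n i : ℕ} (hn : n ≤ M)
    (hi : i < n) : ¬ [B.left i, B.right i] <:+: B.encodeRel 0 n e := by
  induction n with
  | zero => omega
  | succ n ih =>
    intro h
    rw [encodeRel, mergeAt, Nat.zero_add] at h
    obtain ⟨h, hne⟩ := pair_infix_of_infix_mergeStep
      (B.ne_merged_of_le (Nat.lt_succ_iff.1 hi) hn (B.left_ok i (by omega)))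
      (B.ne_merged_of_le (Nat.lt_succ_iff.1 hi) hn (B.right_ok i (by omega))) _ h
    rcases Nat.lt_succ_iff_lt_or_eq.1 hi with hi | rfl
    · exact ih (by omega) hi h
    · exact hne ⟨rfl, rfl⟩

end BPE

/-- **Canonical BPE encodings contain no mergeable adjacent pair (tokenization bias).**
For every byte string `s`, the canonical encoding `encode(s; M)` contains no adjacent
pair of tokens equal to `(t_i^left, t_i^right)` for any merge rule `i ≤ M`;
consequently any token sequence containing such an adjacent pair is not a prefix of the
canonical encoding of any byte string. -/
theorem no_mergeable_adjacent_pair {α : Type*} [DecidableEq α] [Fintype α] {eos : α}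
    {M : ℕ} (B : BPE α eos M) :
    (∀ s : List α, ∀ i < M, ¬ [B.left i, B.right i] <:+: B.encode M s) ∧
    (∀ e : List (List α), (∃ i < M, [B.left i, B.right i] <:+: e) →
      ∀ s : List α, ¬ e <+: B.encode M s) := by
  have h : ∀ s : List α, ∀ i < M, ¬ [B.left i, B.right i] <:+: B.encode M s :=
    fun s i hi => B.not_pair_infix_encodeRel _ le_rfl hi
  exact ⟨h, fun e ⟨i, hi, he⟩ s hs => h s i hi (he.trans hs.isInfix)⟩
end
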